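/- arXiv:1610.00686 — 2 statements merged into one kernel-verified Lean document; each statement's English description precedes it below -/
import Mathlib

section
/- Let F be the free group on two generators a, b, and let c ∈ F. If the element a·c·b·c⁻¹ is conjugate in F to a·b, then there exist integers k, ℓ ∈ ℤ such that c = aᵏ·bˡ. -/
namespace FreeGroup

variable {α : Type*}

theorem IsReduced.norm_mk [DecidableEq α] {L : List (α × Bool)} (h : IsReduced L) :
    (mk L).norm = L.length := by
  rw [norm, toWord_mk, h.reduce_eq]

theorem norm_pow_le [DecidableEq α] (x : FreeGroup α) (n : ℕ) : (x ^ n).norm ≤ n * x.norm := by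
  induction n with
  | zero => simp
  | succ n ih =>
    rw [pow_succ, Nat.succ_mul]
    exact (norm_mul_le _ _).trans (by gcongr)

/-- A cyclically reduced word is shortest in its conjugacy class. -/
theorem IsCyclicallyReduced.length_le_norm_of_isConj [DecidableEq α] {L : List (α × Bool)}
    (hL : IsCyclicallyReduced L) {y : FreeGroup α} (h : IsConj y (mk L)) :
    L.length ≤ y.norm := by
  obtain ⟨w, hw⟩ := isConj_iff.1 h
  have key (n : ℕ) : n * L.length ≤ 2 * w.norm + n * y.norm := by
    calc n * L.length = (mk L ^ n).norm := by
          rw [pow_mk, (hL.flatten_replicate n).isReduced.norm_mk]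
          simp
      _ = (w * y ^ n * w⁻¹).norm := by rw [← hw, conj_pow]
      _ ≤ w.norm + (y ^ n).norm + w⁻¹.norm :=
          (norm_mul_le _ _).trans (by gcongr; exact norm_mul_le _ _)
      _ ≤ 2 * w.norm + n * y.norm := by
          have := norm_pow_le y n
          rw [norm_inv_eq]
          lia
  have := key (2 * w.norm + 1)
  nlinarith

theorem IsReduced.invRev {L : List (α × Bool)} (h : IsReduced L) : IsReduced (invRev L) := by
  classical
  rw [isReduced_iff_reduce_eq, reduce_invRev, h.reduce_eq]

theorem mk_singleton_eq_zpow (a : α) (e : Bool) : ∃ k : ℤ, mk [(a, e)] = of a ^ k := by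
  cases e
  · exact ⟨-1, by rw [zpow_neg_one]; rfl⟩
  · exact ⟨1, by rw [zpow_one]; rfl⟩

/-- If the reduced word `L` neither begins with `a^±¹` nor ends with `b^±¹`, then the word
`a·L·b·L⁻¹` is cyclically reduced. -/
theorem IsReduced.isCyclicallyReduced_conj {L : List (α × Bool)} (hL : IsReduced L) (a b : α)
    (hne : L ≠ []) (hhead : ∀ x ∈ L.head?, x.1 ≠ a) (hlast : ∀ x ∈ L.getLast?, x.1 ≠ b) :
    IsCyclicallyReduced ((a, true) :: L ++ (b, true) :: FreeGroup.invRev L) := by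
  have hinv := hL.invRev
  rw [isCyclicallyReduced_iff]
  unfold IsReduced at *
  simp only [List.isChain_append, List.isChain_cons]
  obtain ⟨x, hx⟩ : ∃ x, L.head? = some x := ⟨_, List.head?_eq_some_head hne⟩
  obtain ⟨z, hz⟩ : ∃ z, L.getLast? = some z := ⟨_, List.getLast?_eq_some_getLast hne⟩
  have hx' : (FreeGroup.invRev L).getLast? = some (x.1, !x.2) := by simp [FreeGroup.invRev, hx]
  have hz' : (FreeGroup.invRev L).head? = some (z.1, !z.2) := by simp [FreeGroup.invRev, hz]
  have h₁ := hhead x hx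
  have h₂ := hlast z hz
  simp [List.getLast?_append, List.getLast?_cons, hx, hz, hx', hz', hL, hinv]
  grind

theorem exists_zpow_mul_zpow_of_isConj {a b : α} (L : List (α × Bool))
    (hL : IsReduced L) (h : IsConj (of a * mk L * of b * (mk L)⁻¹) (of a * of b)) :
    ∃ k l : ℤ, mk L = of a ^ k * of b ^ l := by
  classical
  induction hn : L.length using Nat.strong_induction_on generalizing L with
  | _ n ih =>
  subst hn
  by_cases hne : L = []
  · exact ⟨0, 0, by simp [hne, one_eq_mk]⟩
  by_cases hhead : ∀ x ∈ L.head?, x.1 ≠ a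
  · by_cases hlast : ∀ x ∈ L.getLast?, x.1 ≠ b
    · have hle := (hL.isCyclicallyReduced_conj a b hne hhead hlast).length_le_norm_of_isConj
        (y := of a * of b) (by
          convert h.symm using 1
          simp [of, mul_mk, inv_mk])
      have := norm_mul_le (of a) (of b)
      have := List.length_pos_iff.2 hne
      simp at *
      lia
    · push Not at hlast
      obtain ⟨⟨_, e⟩, hx, rfl⟩ := hlast
      obtain ⟨L, rfl⟩ := List.getLast?_eq_some_iff.1 hx
      obtain ⟨m, hm⟩ := mk_singleton_eq_zpow _ e
      rw [← mul_mk, hm] at h ⊢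
      obtain ⟨k, l, hkl⟩ := ih L.length (by simp) L (hL.infix ⟨[], _, by simp; rfl⟩)
        (by convert h using 1; group) rfl
      exact ⟨k, l + m, by rw [hkl, zpow_add, mul_assoc]⟩
  · push Not at hhead
    obtain ⟨⟨a, e⟩, hx, rfl⟩ := hhead
    obtain ⟨L, rfl⟩ := List.head?_eq_some_iff.1 hx
    obtain ⟨m, hm⟩ := mk_singleton_eq_zpow _ e
    rw [← List.singleton_append, ← mul_mk, hm] at h ⊢
    obtain ⟨k, l, hkl⟩ := ih L.length (by simp) L (hL.infix ⟨[_], [], by simp; rfl⟩)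
      (IsConj.trans (isConj_iff.2 ⟨of a ^ m, by group⟩) h) rfl
    exact ⟨m + k, l, by rw [hkl, zpow_add, mul_assoc]⟩

end FreeGroup

/-- **Lemma 2.6.** In the free group on two generators `a`, `b`, if `a·c·b·c⁻¹` is
conjugate to `a·b`, then `c = aᵏ·bˡ` for some integers `k`, `ℓ`. -/
theorem eq_pow_mul_pow_of_isConj_free_group (c : FreeGroup Bool)
    (h : IsConj (FreeGroup.of true * c * FreeGroup.of false * c⁻¹)
      (FreeGroup.of true * FreeGroup.of false)) :
    ∃ k l : ℤ, c = FreeGroup.of true ^ k * FreeGroup.of false ^ l := by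
  rw [← c.mk_toWord] at h ⊢
  exact FreeGroup.exists_zpow_mul_zpow_of_isConj _ FreeGroup.isReduced_toWord h
end

section
/- Let X be a topological space, α a loop in X based at a point z, and H : S¹ × [0,1] → X a continuous map with H(·,0) = H(·,1) = α (where α is parametrized by S¹ with α(0) = z, identifying 0 with a basepoint of S¹). Let β be the loop β(t) = H(0,t), t ∈ [0,1], which is based at z. Then the homotopy classes [α] and [β] commute in the fundamental group π₁(X, z). -/
open unitInterval

/-- **Fact 2.7.** Let `α` be a loop based at `z` in a topological space `X`, and let
`H : S¹ × [0,1] → X` be a homotopy of loops with `H(·,0) = H(·,1) = α` (the domain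
`S¹ × [0,1]` is encoded by a map on `[0,1] × [0,1]` satisfying `H(0,t) = H(1,t)`).
Then the class of `α` commutes in `π₁(X,z)` with the class of the trajectory
`β : t ↦ H(0,t)` of the basepoint. -/
theorem loop_commutes_with_basepoint_trajectory
    {X : Type} [TopologicalSpace X] (z : X) (α : Path z z)
    (H : unitInterval × unitInterval → X) (hH : Continuous H)
    (h0 : ∀ s, H (s, 0) = α s) (h1 : ∀ s, H (s, 1) = α s)
    (hloop : ∀ t, H (0, t) = H (1, t))
    (β : Path z z) (hβ : ∀ t, β t = H (0, t)) :
    (α.trans β).Homotopic (β.trans α) := by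
  let F : ContinuousMap.Homotopy (⟨fun s => H (s, 0), by fun_prop⟩ : C(I, X))
      ⟨fun s => H (s, 1), by fun_prop⟩ :=
    { toFun := fun p => H (p.2, p.1)
      continuous_toFun := by fun_prop
      map_zero_left := fun _ => rfl
      map_one_left := fun _ => rfl }
  let p : Path (0 : I) 1 := ⟨.id I, rfl, rfl⟩
  have hsource : z = H (0, 0) := by rw [h0, α.source]
  have htarget : z = H (1, 1) := by rw [h1, α.target]
  have key := (Path.Homotopic.map_trans_evalAt F p).pathCast hsource htarget
  convert key using 1
  · ext t
    simp only [Path.trans_apply, Path.cast_coe]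
    split_ifs
    · exact (h0 _).symm
    · exact (hβ _).trans (hloop _)
  · ext t
    simp only [Path.trans_apply, Path.cast_coe]
    split_ifs
    · exact hβ _
    · exact (h1 _).symm
end
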